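/- If w̃₂ ↑ w̃₁ in the up order on Wtf and w̃₂ ∈ Wtf⁺, then w̃₂ ≤ w̃₁ in the Bruhat order on Wtf defined by the dominant base alcove. -/

import Mathlib

/-!
Common setup: the extended affine Weyl group of `GL_n` (f-fold product), its dot
action on `(ℝ^n)^f`, p-alcoves, lengths, Bruhat orders (dominant and antidominant),
the up (↑) order, admissible sets, and the combinatorics of lowest alcove
presentations, following Le–Le Hung–Levin, "Weight elimination in Serre-type
conjectures".
-/

noncomputable section

namespace LLLSerre

open scoped BigOperators

/-- `η₀ = (n-1, n-2, …, 1, 0)`. -/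
def eta0 (n : ℕ) : Fin n → ℤ := fun i => (n : ℤ) - 1 - (i : ℤ)

/-- The action of a permutation on a vector: `(σ x) i = x (σ⁻¹ i)`. -/
def permAct {n : ℕ} {α : Type*} (σ : Equiv.Perm (Fin n)) (x : Fin n → α) : Fin n → α :=
  fun i => x (σ⁻¹ i)

/-- The weight lattice `Xf = (ℤ^n)^f`. -/
abbrev Xf (n f : ℕ) := Fin f → Fin n → ℤ

/-- The f-fold product of Weyl groups `Wf = (S_n)^f`. -/
abbrev WfG (n f : ℕ) := Fin f → Equiv.Perm (Fin n)

/-- Points of `(ℝ^n)^f`. -/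
abbrev RPt (n f : ℕ) := Fin f → Fin n → ℝ

/-- The extended affine Weyl group `Wtf = (X ⋊ W)^f`; the pair `(w, ν)` represents
`w t_ν`. -/
structure Wtf (n f : ℕ) where
  w : WfG n f
  t : Xf n f

/-- Multiplication in `Wtf`: `(w₁ t_{ν₁})(w₂ t_{ν₂}) = w₁w₂ t_{ν₂ + w₂⁻¹(ν₁)}`. -/
def Wtf.mul {n f : ℕ} (a b : Wtf n f) : Wtf n f :=
  ⟨fun j => a.w j * b.w j, fun j => b.t j + permAct (b.w j)⁻¹ (a.t j)⟩

/-- Inversion in `Wtf`: `(w t_ν)⁻¹ = w⁻¹ t_{-w(ν)}`. -/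
def Wtf.inv {n f : ℕ} (a : Wtf n f) : Wtf n f :=
  ⟨fun j => (a.w j)⁻¹, fun j => -(permAct (a.w j) (a.t j))⟩

/-- Embedding of the finite Weyl group `Wf` in `Wtf`. -/
def ofW {n f : ℕ} (w : WfG n f) : Wtf n f := ⟨w, fun _ _ => 0⟩

/-- The translation `t_ν ∈ Wtf`. -/
def transl {n f : ℕ} (ν : Xf n f) : Wtf n f := ⟨fun _ => 1, ν⟩

/-- `η = (η₀, …, η₀) ∈ Xf`. -/
def etaf (n f : ℕ) : Xf n f := fun _ => eta0 n

/-- The longest element `w₀ ∈ Wf`. -/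
def w0f (n f : ℕ) : WfG n f := fun _ => Fin.revPerm

/-- `w₀` as an element of `Wtf`. -/
def w0Elt (n f : ℕ) : Wtf n f := ofW (w0f n f)

/-- `w̃_h = w₀ t_{-η} ∈ Wtf`. -/
def whElt (n f : ℕ) : Wtf n f := ⟨w0f n f, fun _ i => -(eta0 n i)⟩

/-- The dot action of `Wtf` on `(ℝ^n)^f`: `(w t_ν) · x = w(x + η + pν) − η`. -/
def dotR {n f : ℕ} (p : ℕ) (a : Wtf n f) (x : RPt n f) : RPt n f :=
  fun j i =>
    (x j ((a.w j)⁻¹ i) + ((eta0 n ((a.w j)⁻¹ i) : ℤ) : ℝ)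
      + (p : ℝ) * ((a.t j ((a.w j)⁻¹ i) : ℤ) : ℝ)) - ((eta0 n i : ℤ) : ℝ)

/-- The dot action of `Wtf` on integral weights. -/
def dotZ {n f : ℕ} (p : ℕ) (a : Wtf n f) (lam : Xf n f) : Xf n f :=
  fun j i =>
    (lam j ((a.w j)⁻¹ i) + eta0 n ((a.w j)⁻¹ i) + (p : ℤ) * a.t j ((a.w j)⁻¹ i)) - eta0 n i

/-- `⟨x_j + η₀, α_{ik}^∨⟩` for a real point `x`. -/
def prR {n f : ℕ} (x : RPt n f) (j : Fin f) (i k : Fin n) : ℝ :=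
  (x j i + ((eta0 n i : ℤ) : ℝ)) - (x j k + ((eta0 n k : ℤ) : ℝ))

/-- `⟨λ_j + η₀, α_{ik}^∨⟩` for a weight `λ`. -/
def prZ {n f : ℕ} (lam : Xf n f) (j : Fin f) (i k : Fin n) : ℤ :=
  (lam j i + eta0 n i) - (lam j k + eta0 n k)

/-- A point is (p-)regular if it lies on none of the affine hyperplanes
`⟨x_j + η₀, α^∨⟩ = pm`. -/
def regular {n f : ℕ} (p : ℕ) (x : RPt n f) : Prop :=
  ∀ (j : Fin f) (i k : Fin n) (m : ℤ), i < k → prR x j i k ≠ (p : ℝ) * (m : ℝ)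

/-- Two regular points lie in the same p-alcove (same side of every hyperplane). -/
def sameAlcove {n f : ℕ} (p : ℕ) (x y : RPt n f) : Prop :=
  regular p x ∧ regular p y ∧
    ∀ (j : Fin f) (i k : Fin n) (m : ℤ), i < k →
      (prR x j i k < (p : ℝ) * (m : ℝ) ↔ prR y j i k < (p : ℝ) * (m : ℝ))

/-- The root `α_{ik} = e_i - e_k` as a real vector. -/
def rootR {n : ℕ} (i k i' : Fin n) : ℝ :=
  (if i' = i then (1 : ℝ) else 0) - (if i' = k then (1 : ℝ) else 0)

/-- The affine reflection across the hyperplane `⟨x_j + η₀, α_{ik}^∨⟩ = pm`: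
it replaces `x_j` by `x_j − (⟨x_j + η₀, α_{ik}^∨⟩ − pm) α_{ik}`. -/
def reflPt {n f : ℕ} (p : ℕ) (j : Fin f) (i k : Fin n) (m : ℤ) (x : RPt n f) : RPt n f :=
  fun j' i' =>
    if j' = j then x j' i' - (prR x j i k - (p : ℝ) * (m : ℝ)) * rootR i k i' else x j' i'

/-- The origin, a point of the base alcove `C₀` (when `p > n`). -/
def basePt (n f : ℕ) : RPt n f := fun _ _ => 0

/-- The hyperplane indexed by `(j, i, k, m)` separates `x` from `y`. -/
def separates {n f : ℕ} (p : ℕ) (x y : RPt n f) (j : Fin f) (i k : Fin n) (m : ℤ) : Prop :=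
  (prR x j i k < (p : ℝ) * (m : ℝ) ∧ (p : ℝ) * (m : ℝ) < prR y j i k) ∨
  (prR y j i k < (p : ℝ) * (m : ℝ) ∧ (p : ℝ) * (m : ℝ) < prR x j i k)

/-- The length of `a ∈ Wtf` measured from the alcove of the base point `x`:
the number of hyperplanes separating the alcove of `x` from its image under `a`. -/
def lenFrom {n f : ℕ} (p : ℕ) (x : RPt n f) (a : Wtf n f) : ℕ :=
  Set.ncard {q : Fin f × Fin n × Fin n × ℤ |
    q.2.1 < q.2.2.1 ∧ separates p x (dotR p a x) q.1 q.2.1 q.2.2.1 q.2.2.2}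

/-- Length relative to the dominant base alcove `C₀`. -/
def len {n f : ℕ} (p : ℕ) (a : Wtf n f) : ℕ := lenFrom p (basePt n f) a

/-- A point of the antidominant base alcove `w₀ · C₀`. -/
def antiBasePt (n f p : ℕ) : RPt n f := dotR p (w0Elt n f) (basePt n f)

/-- Length relative to the antidominant base alcove `w₀ · C₀`. -/
def lenV {n f : ℕ} (p : ℕ) (a : Wtf n f) : ℕ := lenFrom p (antiBasePt n f p) a

/-- The affine Weyl group `Waf = (Λ_R ⋊ W)^f ⊆ Wtf`. -/
def Waf (n f : ℕ) : Set (Wtf n f) := {a | ∀ j, (∑ i, a.t j i) = 0}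

/-- The stabilizer `Ωf` of the dominant base alcove `C₀`. -/
def Omegaf (n f p : ℕ) : Set (Wtf n f) :=
  {a | sameAlcove p (basePt n f) (dotR p a (basePt n f))}

/-- The stabilizer of the antidominant base alcove `w₀ · C₀`. -/
def OmegaV (n f p : ℕ) : Set (Wtf n f) :=
  {a | sameAlcove p (antiBasePt n f p) (dotR p a (antiBasePt n f p))}

/-- `a ∈ Wtf` acts via the dot action as the affine reflection in a single hyperplane. -/
def isRefl {n f : ℕ} (p : ℕ) (a : Wtf n f) : Prop :=
  ∃ (j : Fin f) (i k : Fin n) (m : ℤ), i < k ∧ ∀ x, dotR p a x = reflPt p j i k m x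

/-- One step of the Bruhat order (relative to the base point `x`):
`u < r u` for `r` a reflection with `ℓ(u) < ℓ(r u)`. -/
def bruhatStepFrom {n f : ℕ} (p : ℕ) (x : RPt n f) (u v : Wtf n f) : Prop :=
  ∃ r, isRefl p r ∧ v = Wtf.mul r u ∧ lenFrom p x u < lenFrom p x v

/-- The Bruhat order on `Wtf` relative to the base alcove with representative
point `x` and stabilizer `Ω`: on `Waf` it is generated by the reflection steps,
and is extended to `Wtf` by `u ω ≤ v ω` for `u ≤ v` in `Waf`, `ω ∈ Ω`. -/
def bruhatLEFrom {n f : ℕ} (p : ℕ) (x : RPt n f) (Om : Set (Wtf n f)) (a b : Wtf n f) : Prop :=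
  ∃ u v ω, u ∈ Waf n f ∧ v ∈ Waf n f ∧ ω ∈ Om ∧
    a = Wtf.mul u ω ∧ b = Wtf.mul v ω ∧
    Relation.ReflTransGen (bruhatStepFrom p x) u v

/-- The Bruhat order on `Wtf` relative to the dominant base alcove. -/
def bruhatLE {n f : ℕ} (p : ℕ) (a b : Wtf n f) : Prop :=
  bruhatLEFrom p (basePt n f) (Omegaf n f p) a b

/-- The Bruhat order on `Wtf` relative to the antidominant base alcove. -/
def bruhatLEV {n f : ℕ} (p : ℕ) (a b : Wtf n f) : Prop :=
  bruhatLEFrom p (antiBasePt n f p) (OmegaV n f p) a b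

/-- The admissible set `Adm(λ) = {w̃ : w̃ ≤ t_{σ(λ)} for some σ ∈ Wf}` (dominant order). -/
def Adm {n f : ℕ} (p : ℕ) (lam : Xf n f) : Set (Wtf n f) :=
  {a | ∃ σ : WfG n f, bruhatLE p a (transl (fun j => permAct (σ j) (lam j)))}

/-- The admissible set `Adm∨(λ)` (antidominant order). -/
def AdmV {n f : ℕ} (p : ℕ) (lam : Xf n f) : Set (Wtf n f) :=
  {a | ∃ σ : WfG n f, bruhatLEV p a (transl (fun j => permAct (σ j) (lam j)))}

/-- The anti-automorphism `w̃ = w t_ν ↦ w̃* = t_{ν*} w*` of `Wtf`, where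
`(w*)_j = (w_{f-1-j})⁻¹` and `(ν*)_j = ν_{f-1-j}`. -/
def wstar {n f : ℕ} (a : Wtf n f) : Wtf n f :=
  ⟨fun j => (a.w (Fin.rev j))⁻¹, fun j => permAct (a.w (Fin.rev j)) (a.t (Fin.rev j))⟩

/-- `ν ↦ ν*` on weights: `(ν*)_j = ν_{f-1-j}`. -/
def xstar {n f : ℕ} (lam : Xf n f) : Xf n f := fun j => lam (Fin.rev j)

/-- The cyclic shift `π` on weights: `(πν)_j = ν_{j-1}`. -/
def sh {n f : ℕ} (ν : Xf n f) : Xf n f := fun j => ν ((finRotate f)⁻¹ j)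

/-- The cyclic shift `π` on `Wf`: `(πσ)_j = σ_{j-1}`. -/
def shW {n f : ℕ} (σ : WfG n f) : WfG n f := fun j => σ ((finRotate f)⁻¹ j)

/-- The `Wf`-part of `^(ν,σ)(w, μ)`, namely `σ w π(σ)⁻¹`. -/
def conjW {n f : ℕ} (σ w : WfG n f) : WfG n f := fun j => σ j * w j * (shW σ j)⁻¹

/-- The `Xf`-part of `^(ν,σ)(w, μ)`, namely `σ(μ) + pν − σwπ(σ)⁻¹ π(ν)`. -/
def conjX {n f : ℕ} (p : ℕ) (ν : Xf n f) (σ w : WfG n f) (μ : Xf n f) : Xf n f :=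
  fun j i => permAct (σ j) (μ j) i + (p : ℤ) * ν j i - permAct (conjW σ w j) (sh ν j) i

/-- `(w, μ) ∼ (w', μ')`: `(w', μ') = ^(ν,σ)(w, μ)` for some `(ν, σ)`. -/
def pairEquiv {n f : ℕ} (p : ℕ) (w : WfG n f) (μ : Xf n f) (w' : WfG n f) (μ' : Xf n f) : Prop :=
  ∃ (ν : Xf n f) (σ : WfG n f), w' = conjW σ w ∧ μ' = conjX p ν σ w μ

/-- `λ` is m-deep in the base alcove `C₀`:
`m < ⟨λ_j + η₀, α^∨⟩ < p − m` for all `j` and positive coroots `α^∨`. -/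
def deep {n f : ℕ} (p m : ℕ) (lam : Xf n f) : Prop :=
  ∀ (j : Fin f) (i k : Fin n), i < k →
    (m : ℤ) < prZ lam j i k ∧ prZ lam j i k < (p : ℤ) - (m : ℤ)

/-- `λ` lies m-deep in its own p-alcove. -/
def deepInAlcove {n f : ℕ} (p m : ℕ) (lam : Xf n f) : Prop :=
  ∀ (j : Fin f) (i k : Fin n), i < k →
    ∃ N : ℤ, (p : ℤ) * N + (m : ℤ) < prZ lam j i k ∧
      prZ lam j i k < (p : ℤ) * (N + 1) - (m : ℤ)

/-- The p-restricted weights `X₁`. -/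
def X1 (n f p : ℕ) : Set (Xf n f) :=
  {lam | ∀ (j : Fin f) (i : Fin n) (h : (i : ℕ) + 1 < n),
    0 ≤ lam j i - lam j ⟨(i : ℕ) + 1, h⟩ ∧ lam j i - lam j ⟨(i : ℕ) + 1, h⟩ ≤ (p : ℤ) - 1}

/-- `X⁰`: weights pairing to 0 with every coroot. -/
def X0 (n f : ℕ) : Set (Xf n f) := {lam | ∀ (j : Fin f) (i k : Fin n), lam j i = lam j k}

/-- The alcove of the regular point `x` is dominant. -/
def dominantPt {n f : ℕ} (x : RPt n f) : Prop :=
  ∀ (j : Fin f) (i k : Fin n), i < k → 0 < prR x j i k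

/-- The alcove of the regular point `x` is p-restricted. -/
def restrictedPt {n f : ℕ} (p : ℕ) (x : RPt n f) : Prop :=
  ∀ (j : Fin f) (i : Fin n) (h : (i : ℕ) + 1 < n),
    0 < prR x j i ⟨(i : ℕ) + 1, h⟩ ∧ prR x j i ⟨(i : ℕ) + 1, h⟩ < (p : ℝ)

/-- `Wtf⁺`: the elements sending `C₀` to a dominant alcove under the dot action. -/
def WtfPlus (n f p : ℕ) : Set (Wtf n f) := {a | dominantPt (dotR p a (basePt n f))}

/-- One step of the up (↑) order on alcoves, via representative points:
stay in the same alcove, or apply a reflection across a hyperplane lying above. -/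
def upStep {n f : ℕ} (p : ℕ) (x y : RPt n f) : Prop :=
  sameAlcove p x y ∨
    ∃ (j : Fin f) (i k : Fin n) (m : ℤ), i < k ∧ prR x j i k < (p : ℝ) * (m : ℝ) ∧
      y = reflPt p j i k m x

/-- The up (↑) order on p-alcoves, via representative points. -/
def alcoveLE {n f : ℕ} (p : ℕ) (x y : RPt n f) : Prop :=
  Relation.ReflTransGen (upStep p) x y

/-- `w̃₁ ↑ w̃₂` on `Wtf`: `w̃₁ · C₀ ↑ w̃₂ · C₀` and `w̃₁, w̃₂` in the same right
`Waf`-coset. -/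
def upOrd {n f : ℕ} (p : ℕ) (a b : Wtf n f) : Prop :=
  alcoveLE p (dotR p a (basePt n f)) (dotR p b (basePt n f)) ∧
    Wtf.mul a (Wtf.inv b) ∈ Waf n f

/-- Realification of an integral weight. -/
def toR {n f : ℕ} (lam : Xf n f) : RPt n f := fun j i => ((lam j i : ℤ) : ℝ)

/-- The `Wf`-orbit of a point of `(ℝ^n)^f`. -/
def orbitR {n f : ℕ} (y : RPt n f) : Set (RPt n f) :=
  Set.range fun σ : WfG n f => fun j => permAct (σ j) (y j)

end LLLSerre

namespace LLLSerre

theorem Wtf.ext' {n f : ℕ} {a b : Wtf n f} (hw : ∀ j i, a.w j i = b.w j i)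
    (ht : ∀ j i, a.t j i = b.t j i) : a = b := by
  cases a; cases b
  congr
  · funext j; exact Equiv.ext (hw j)
  · funext j i; exact ht j i

/-- The extended affine Weyl group as a group. -/
instance instGroupWtf {n f : ℕ} : Group (Wtf n f) where
  mul := Wtf.mul
  one := ⟨fun _ => 1, fun _ _ => 0⟩
  inv := Wtf.inv
  mul_assoc a b c := Wtf.ext' (fun _ _ => rfl) fun j i => by
    change c.t j i + (b.t j _ + a.t j _) = (c.t j i + b.t j ((c.w j)⁻¹⁻¹ i)) + a.t j ((b.w j * c.w j)⁻¹⁻¹ i)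
    simp [add_assoc]
  one_mul a := Wtf.ext' (fun _ _ => rfl) fun j i => by
    change a.t j i + 0 = a.t j i
    simp
  mul_one a := Wtf.ext' (fun _ _ => rfl) fun j i => by
    change 0 + a.t j i = a.t j i
    simp
  inv_mul_cancel a := Wtf.ext'
    (fun j i => by change (a.w j)⁻¹ (a.w j i) = i; simp)
    fun j i => by
      change a.t j i + -(a.t j ((a.w j)⁻¹ ((a.w j)⁻¹⁻¹ i))) = 0
      simp

namespace Wtf

variable {n f : ℕ}

theorem mul_eq (a b : Wtf n f) : Wtf.mul a b = a * b := rfl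

theorem inv_eq (a : Wtf n f) : Wtf.inv a = a⁻¹ := rfl

@[simp] theorem one_w (j : Fin f) : (1 : Wtf n f).w j = 1 := rfl

@[simp] theorem one_t (j : Fin f) (i : Fin n) : (1 : Wtf n f).t j i = 0 := rfl

@[simp] theorem mul_w (a b : Wtf n f) (j : Fin f) : (a * b).w j = a.w j * b.w j := rfl

@[simp] theorem inv_w (a : Wtf n f) (j : Fin f) : (a⁻¹).w j = (a.w j)⁻¹ := rfl

@[simp] theorem mul_t (a b : Wtf n f) (j : Fin f) (i : Fin n) :
    (a * b).t j i = b.t j i + a.t j (b.w j i) := by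
  change b.t j i + a.t j ((b.w j)⁻¹⁻¹ i) = _
  simp

@[simp] theorem inv_t (a : Wtf n f) (j : Fin f) (i : Fin n) :
    (a⁻¹).t j i = -a.t j ((a.w j)⁻¹ i) := rfl

end Wtf

section Action

variable {n f : ℕ} (p : ℕ)

theorem dotR_mul (a b : Wtf n f) (x : RPt n f) : dotR p (a * b) x = dotR p a (dotR p b x) := by
  funext j i
  simp only [dotR, Wtf.mul_w, Wtf.mul_t, mul_inv_rev, Equiv.Perm.mul_apply,
    Equiv.Perm.coe_inv, Equiv.apply_symm_apply]
  push_cast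
  ring

@[simp] theorem dotR_one (x : RPt n f) : dotR p (1 : Wtf n f) x = x := by
  funext j i
  simp [dotR]

theorem one_mem_Waf : (1 : Wtf n f) ∈ Waf n f := fun j => by simp

theorem sum_mul_t (a b : Wtf n f) (j : Fin f) :
    ∑ i, (a * b).t j i = ∑ i, a.t j i + ∑ i, b.t j i := by
  simp only [Wtf.mul_t, Finset.sum_add_distrib, Equiv.sum_comp (b.w j) (a.t j), add_comm]

theorem sum_inv_t (a : Wtf n f) (j : Fin f) : ∑ i, (a⁻¹).t j i = -∑ i, a.t j i := by
  simp only [Wtf.inv_t, Finset.sum_neg_distrib, Equiv.sum_comp (a.w j)⁻¹ (a.t j)]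

theorem mul_mem_Waf {a b : Wtf n f} (ha : a ∈ Waf n f) (hb : b ∈ Waf n f) :
    a * b ∈ Waf n f := fun j => by
  rw [sum_mul_t, ha j, hb j, add_zero]

end Action

/-- The tuple `(j, a, b, m)` stands for the half-space on which the affine functional
`⟨x_j + η₀, α_{ab}^∨⟩ - pm` is positive; `a` and `b` come in either order. -/
abbrev HalfSpace (n f : ℕ) := Fin f × Fin n × Fin n × ℤ

namespace HalfSpace

variable {n f : ℕ} (p : ℕ)

/-- The affine functional attached to a half-space. -/
def ev (h : HalfSpace n f) (x : RPt n f) : ℝ :=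
  prR x h.1 h.2.1 h.2.2.1 - (p : ℝ) * (h.2.2.2 : ℝ)

/-- The opposite half-space. -/
def opp (h : HalfSpace n f) : HalfSpace n f := (h.1, h.2.2.1, h.2.1, -h.2.2.2)

/-- The image of a half-space under the dot action. -/
def act (g : Wtf n f) (h : HalfSpace n f) : HalfSpace n f :=
  (h.1, g.w h.1 h.2.1, g.w h.1 h.2.2.1, h.2.2.2 + g.t h.1 h.2.1 - g.t h.1 h.2.2.1)

/-- The affine reflection in the boundary of a half-space, as a group element. -/
def reflElt (h : HalfSpace n f) : Wtf n f where
  w j := if j = h.1 then Equiv.swap h.2.1 h.2.2.1 else 1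
  t j i := if j = h.1 then
    (if i = h.2.2.1 then h.2.2.2 else 0) - (if i = h.2.1 then h.2.2.2 else 0) else 0

@[simp] theorem ev_opp (h : HalfSpace n f) (x : RPt n f) : ev p (opp h) x = -ev p h x := by
  simp only [ev, opp, prR]
  push_cast
  ring

@[simp] theorem opp_opp (h : HalfSpace n f) : opp (opp h) = h := by
  simp [opp]

theorem ev_act (g : Wtf n f) (h : HalfSpace n f) (x : RPt n f) :
    ev p (act g h) (dotR p g x) = ev p h x := by
  simp only [ev, act, prR, dotR, Equiv.Perm.coe_inv, Equiv.symm_apply_apply]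
  push_cast
  ring

theorem act_mul (g g' : Wtf n f) (h : HalfSpace n f) : act (g * g') h = act g (act g' h) := by
  simp only [act, Wtf.mul_w, Wtf.mul_t, Equiv.Perm.mul_apply, Prod.mk.injEq, true_and]
  ring

@[simp] theorem act_one (h : HalfSpace n f) : act 1 h = h := by
  simp [act]

theorem ev_dotR (g : Wtf n f) (h : HalfSpace n f) (x : RPt n f) :
    ev p h (dotR p g x) = ev p (act g⁻¹ h) x := by
  rw [← ev_act p g (act g⁻¹ h) x, ← act_mul, mul_inv_cancel, act_one]

theorem act_injective (g : Wtf n f) : Function.Injective (act g) := fun h h' e => by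
  have := congrArg (act g⁻¹) e
  simpa [← act_mul] using this

theorem refl_opp (h : HalfSpace n f) : reflElt (opp h) = reflElt h := by
  refine Wtf.ext' (fun j i => ?_) fun j i => ?_
  · simp only [reflElt, opp, Equiv.swap_comm]
  · obtain ⟨j₀, a, b, m⟩ := h
    change (if j = j₀ then (if i = a then -m else 0) - (if i = b then -m else 0) else 0) =
      if j = j₀ then (if i = b then m else 0) - (if i = a then m else 0) else 0
    split_ifs <;> simp

theorem refl_mul_self (h : HalfSpace n f) : reflElt h * reflElt h = 1 := by
  obtain ⟨j₀, a, b, m⟩ := h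
  refine Wtf.ext' (fun j i => ?_) fun j i => ?_
  · simp only [Wtf.mul_w, reflElt]
    split_ifs <;> simp
  · simp only [Wtf.mul_t, reflElt, Wtf.one_t]
    by_cases hj : j = j₀
    · simp only [hj, if_true, Equiv.swap_apply_def]
      split_ifs <;> simp_all
    · simp [hj]

theorem refl_act_mul (g : Wtf n f) (h : HalfSpace n f) : reflElt (act g h) * g = g * reflElt h := by
  obtain ⟨j₀, a, b, m⟩ := h
  refine Wtf.ext' (fun j i => ?_) fun j i => ?_
  · simp only [Wtf.mul_w, reflElt, act]
    by_cases hj : j = j₀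
    · subst hj
      simp [Equiv.swap_apply_apply]
    · simp [hj]
  · simp only [Wtf.mul_t, reflElt, act]
    by_cases hj : j = j₀
    · subst hj
      simp only [if_true, Equiv.swap_apply_def, EmbeddingLike.apply_eq_iff_eq]
      split_ifs <;> simp_all
      ring
    · simp [hj]

theorem refl_mem_Waf (h : HalfSpace n f) : reflElt h ∈ Waf n f := fun j => by
  simp only [reflElt]
  split_ifs <;> simp

theorem dotR_refl (h : HalfSpace n f) (hne : h.2.1 ≠ h.2.2.1) (x : RPt n f) :
    dotR p (reflElt h) x = reflPt p h.1 h.2.1 h.2.2.1 h.2.2.2 x := by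
  obtain ⟨j₀, a, b, m⟩ := h
  funext j i
  simp only [ne_eq] at hne
  by_cases hj : j = j₀
  · subst hj
    simp only [dotR, reflPt, reflElt, if_true, prR, rootR, Equiv.swap_inv, Equiv.swap_apply_def]
    by_cases hia : i = a
    · subst hia
      simp [hne, Ne.symm hne]
      ring
    · by_cases hib : i = b
      · subst hib
        simp [hia, hne]
        ring
      · simp [hia, hib]
  · simp [dotR, reflPt, reflElt, hj]

theorem exists_ev_refl (h k : HalfSpace n f) (hne : k.2.1 ≠ k.2.2.1) :
    ∃ c : ℝ, ∀ x, ev p h (dotR p (reflElt k) x) = ev p h x - ev p k x * c := by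
  by_cases hj : h.1 = k.1
  · refine ⟨rootR k.2.1 k.2.2.1 h.2.1 - rootR k.2.1 k.2.2.1 h.2.2.1, fun x => ?_⟩
    simp only [dotR_refl p k hne, ev, prR, reflPt, hj, if_true]
    ring
  · refine ⟨0, fun x => ?_⟩
    simp only [dotR_refl p k hne, ev, prR, reflPt, hj, if_false]
    ring

theorem ev_refl_self (k : HalfSpace n f) (hne : k.2.1 ≠ k.2.2.1) (x : RPt n f) :
    ev p k (dotR p (reflElt k) x) = -ev p k x := by
  simp only [dotR_refl p k hne, ev, prR, reflPt, if_true, rootR, hne, hne.symm, if_false]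
  ring

theorem dotR_refl_refl (k : HalfSpace n f) (x : RPt n f) :
    dotR p (reflElt k) (dotR p (reflElt k) x) = x := by
  rw [← dotR_mul, refl_mul_self, dotR_one]

theorem isRefl_refl (h : HalfSpace n f) (hne : h.2.1 ≠ h.2.2.1) : isRefl p (reflElt h) := by
  rcases lt_or_gt_of_ne hne with hlt | hlt
  · exact ⟨_, _, _, _, hlt, dotR_refl p h hne⟩
  · exact ⟨_, _, _, _, hlt, by rw [← refl_opp]; exact dotR_refl p (opp h) hne.symm⟩

/-- The half-spaces containing `y` whose opposites contain `x`. -/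
def between (x y : RPt n f) : Set (HalfSpace n f) := {h | ev p h x < 0 ∧ 0 < ev p h y}

variable {p}

theorem between_finite (hp : 0 < p) (x y : RPt n f) : (between p x y).Finite := by
  have hp' : (0 : ℝ) < p := by exact_mod_cast hp
  refine (Set.finite_iUnion fun q : Fin f × Fin n × Fin n =>
    (Set.finite_Icc ⌊prR x q.1 q.2.1 q.2.2 / p⌋ ⌈prR y q.1 q.2.1 q.2.2 / p⌉).image
      fun m : ℤ => ((q.1, q.2.1, q.2.2, m) : HalfSpace n f)).subset ?_
  rintro ⟨j, a, b, m⟩ ⟨h₁, h₂⟩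
  simp only [ev, sub_neg, sub_pos] at h₁ h₂
  refine Set.mem_iUnion.2 ⟨(j, a, b), m, ⟨?_, ?_⟩, rfl⟩
  · have : prR x j a b / p < m := by rw [div_lt_iff₀ hp']; linarith
    exact_mod_cast (Int.floor_le _).trans this.le
  · have : (m : ℝ) < prR y j a b / p := by rw [lt_div_iff₀ hp']; linarith
    exact_mod_cast this.le.trans (Int.le_ceil _)

theorem lenFrom_eq_ncard (x : RPt n f) (g : Wtf n f) :
    lenFrom p x g = (between p x (dotR p g x)).ncard := by
  set y := dotR p g x
  let fold : HalfSpace n f → HalfSpace n f := fun h => if h.2.1 < h.2.2.1 then h else opp h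
  have hinj : Set.InjOn fold (between p x y) := by
    intro h hh k hk e
    have h₁ := hh.1
    have k₁ := hk.1
    simp only [fold] at e
    split_ifs at e
    · exact e
    · rw [e, ev_opp] at h₁; linarith
    · rw [← e, ev_opp] at k₁; linarith
    · simpa using congrArg opp e
  rw [← hinj.ncard_image, lenFrom]
  congr 1
  ext q
  constructor
  · rintro ⟨hlt, hs | hs⟩
    · refine ⟨q, ⟨?_, ?_⟩, by simp only [fold, if_pos hlt]⟩ <;> simp only [ev] <;> linarith
    · refine ⟨opp q, ⟨?_, ?_⟩, ?_⟩
      · rw [ev_opp]; simp only [ev]; linarith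
      · rw [ev_opp]; simp only [ev]; linarith
      · have : ¬ (opp q).2.1 < (opp q).2.2.1 := not_lt.2 hlt.le
        simp only [fold, if_neg this, opp_opp]
  · rintro ⟨h, ⟨h₁, h₂⟩, rfl⟩
    by_cases hlt : h.2.1 < h.2.2.1
    · simp only [fold, if_pos hlt]
      refine ⟨hlt, Or.inl ⟨?_, ?_⟩⟩ <;> simp only [ev] at h₁ h₂ <;> linarith
    · have hne : h.2.1 ≠ h.2.2.1 := by
        intro e
        simp only [ev, prR, e] at h₁ h₂
        linarith
      simp only [fold, if_neg hlt]
      refine ⟨lt_of_le_of_ne (not_lt.1 hlt) hne.symm, Or.inr ?_⟩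
      rw [← neg_neg (ev p h x), ← ev_opp] at h₁
      rw [← neg_neg (ev p h y), ← ev_opp] at h₂
      simp only [ev] at h₁ h₂
      constructor <;> linarith

theorem ncard_between_lt (hp : 0 < p) {k : HalfSpace n f} (hne : k.2.1 ≠ k.2.2.1)
    {c x : RPt n f} (hc : ev p k c < 0) (hx : ev p k x < 0) :
    (between p c x).ncard < (between p c (dotR p (reflElt k) x)).ncard := by
  classical
  have hact : ∀ h z, ev p (act (reflElt k) h) z = ev p h (dotR p (reflElt k) z) := fun h z => by
    rw [← ev_act p (reflElt k) h, dotR_refl_refl]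
  let φ : HalfSpace n f → HalfSpace n f := fun h =>
    if 0 < ev p h (dotR p (reflElt k) x) then h else act (reflElt k) h
  have hinj : Set.InjOn φ (between p c x) := by
    intro h hh h' hh' e
    simp only [φ] at e
    split_ifs at e with h₁ h₂ h₂
    · exact e
    · have := hh.2
      rw [e, hact] at this
      exact absurd this h₂
    · have := hh'.2
      rw [← e, hact] at this
      exact absurd this h₁
    · exact act_injective _ e
  rw [← hinj.ncard_image]
  refine Set.ncard_lt_ncard (Set.ssubset_iff_of_subset ?_ |>.2 ⟨k, ⟨hc, ?_⟩, ?_⟩)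
    (between_finite hp _ _)
  · rintro _ ⟨h, ⟨h₁, h₂⟩, rfl⟩
    by_cases hpos : 0 < ev p h (dotR p (reflElt k) x)
    · simp only [φ, if_pos hpos]
      exact ⟨h₁, hpos⟩
    · simp only [φ, if_neg hpos]
      refine ⟨?_, ?_⟩
      · rw [hact]
        obtain ⟨d, hd⟩ := exists_ev_refl p h k hne
        rw [hd] at hpos ⊢
        have : d < 0 := by nlinarith
        nlinarith
      · rwa [hact, dotR_refl_refl]
  · rw [ev_refl_self p k hne]; linarith
  · rintro ⟨h, ⟨h₁, h₂⟩, e⟩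
    by_cases hpos : 0 < ev p h (dotR p (reflElt k) x)
    · simp only [φ, if_pos hpos] at e
      subst e
      linarith
    · simp only [φ, if_neg hpos] at e
      have h₃ : ev p k (dotR p (reflElt k) c) = ev p h c := by
        rw [← ev_act p (reflElt k) h c, e]
      rw [ev_refl_self p k hne] at h₃
      linarith

/-- The points lie in exactly the same half-spaces. -/
def SameSide (p : ℕ) (x y : RPt n f) : Prop :=
  ∀ h : HalfSpace n f, ev p h x < 0 ↔ ev p h y < 0

theorem SameSide.symm {x y : RPt n f} (h : SameSide p x y) : SameSide p y x :=
  fun k => (h k).symm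

theorem SameSide.trans {x y z : RPt n f} (h : SameSide p x y) (h' : SameSide p y z) :
    SameSide p x z := fun k => (h k).trans (h' k)

theorem SameSide.dotR {x y : RPt n f} (h : SameSide p x y) (g : Wtf n f) :
    SameSide p (dotR p g x) (dotR p g y) := fun k => by
  rw [ev_dotR, ev_dotR]
  exact h _

theorem sameSide_of_sameAlcove {x y : RPt n f} (h : sameAlcove p x y) : SameSide p x y := by
  obtain ⟨hx, hy, hxy⟩ := h
  rintro ⟨j, a, b, m⟩
  rcases lt_trichotomy a b with hab | rfl | hab
  · simpa [ev] using hxy j a b m hab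
  · simp [ev, prR]
  · have hk := hxy j b a (-m) hab
    have hx' := hx j b a (-m) hab
    have hy' := hy j b a (-m) hab
    simp only [ev, prR] at *
    push_cast at *
    constructor
    · intro h₁
      by_contra h₂
      have := hk.2 (lt_of_le_of_ne (by linarith) hy')
      linarith
    · intro h₁
      by_contra h₂
      have := hk.1 (lt_of_le_of_ne (by linarith) hx')
      linarith

end HalfSpace

open HalfSpace

section Orbit

variable {n f p : ℕ}

theorem ev_basePt (h : HalfSpace n f) : ev p h (basePt n f) =
    ((((h.2.2.1 : ℕ) : ℤ) - ((h.2.1 : ℕ) : ℤ) - (p : ℤ) * h.2.2.2 : ℤ) : ℝ) := by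
  simp only [ev, prR, basePt, eta0]
  push_cast
  ring

theorem ev_basePt_ne_zero (hnp : n < p) {h : HalfSpace n f} (hne : h.2.1 ≠ h.2.2.1) :
    ev p h (basePt n f) ≠ 0 := by
  obtain ⟨j, a, b, m⟩ := h
  rw [ev_basePt]
  simp only at *
  intro h0
  have h1 : ((b : ℕ) : ℤ) - ((a : ℕ) : ℤ) - (p : ℤ) * m = 0 := by exact_mod_cast h0
  have hd : ((p : ℕ) : ℤ) ∣ ((b : ℕ) : ℤ) - ((a : ℕ) : ℤ) := ⟨m, by linarith⟩
  have := a.isLt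
  have := b.isLt
  have h2 := Int.eq_zero_of_abs_lt_dvd hd (by rw [abs_lt]; constructor <;> omega)
  exact hne (Fin.ext (by omega))

theorem ev_orbit_ne_zero (hnp : n < p) (g : Wtf n f) {h : HalfSpace n f}
    (hne : h.2.1 ≠ h.2.2.1) : ev p h (dotR p g (basePt n f)) ≠ 0 := by
  rw [ev_dotR]
  exact ev_basePt_ne_zero hnp (by simpa [act] using hne)

theorem regular_orbit (hnp : n < p) (g : Wtf n f) : regular p (dotR p g (basePt n f)) := by
  intro j i k m hik h
  exact ev_orbit_ne_zero hnp g (h := (j, i, k, m)) hik.ne (by simp [ev, h])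

theorem mem_Omegaf_of_sameSide (hnp : n < p) {g : Wtf n f}
    (h : SameSide p (basePt n f) (dotR p g (basePt n f))) : g ∈ Omegaf n f p := by
  refine ⟨by simpa using regular_orbit hnp (1 : Wtf n f), regular_orbit hnp g,
    fun j i k m _ => ?_⟩
  simpa [ev] using h (j, i, k, m)

/-- `Waf` acts freely on alcoves. -/
theorem eq_one_of_sameSide (hnp : n < p) {g : Wtf n f} (hg : g ∈ Waf n f)
    (h : SameSide p (basePt n f) (dotR p g (basePt n f))) : g = 1 := by
  have hev : ∀ (j : Fin f) (a b : Fin n) (m : ℤ),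
      ((b : ℕ) : ℤ) - ((a : ℕ) : ℤ) - p * (m + g.t j b - g.t j a) < 0 ↔
        (((g.w j b : ℕ) : ℤ) - ((g.w j a : ℕ) : ℤ)) - p * m < 0 := fun j a b m => by
    have := h (j, g.w j a, g.w j b, m)
    rw [ev_dotR, ev_basePt, ev_basePt] at this
    simp only [act, Wtf.inv_w, Wtf.inv_t, Equiv.Perm.coe_inv, Equiv.symm_apply_apply] at this
    rw [Int.cast_lt_zero, Int.cast_lt_zero] at this
    rw [this]
    ring_nf
  have htle : ∀ j a b, g.t j a - g.t j b ≤ 1 := fun j a b => by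
    by_contra hlt
    have hlt : 2 ≤ g.t j a - g.t j b := by omega
    have ha := a.isLt
    have hb := b.isLt
    have hwa := (g.w j a).isLt
    have hwb := (g.w j b).isLt
    have h1 := (hev j a b 1).2 (by omega)
    nlinarith
  have ht : ∀ j a, g.t j a = 0 := fun j => by
    have hsum := hg j
    by_cases hneg : ∃ a, g.t j a < 0
    · obtain ⟨a, ha⟩ := hneg
      have : ∑ i, g.t j i < ∑ i : Fin n, (0 : ℤ) :=
        Finset.sum_lt_sum (fun b _ => by have := htle j b a; omega)
          ⟨a, Finset.mem_univ _, ha⟩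
      simp [hsum] at this
    · push Not at hneg
      intro a
      exact (Finset.sum_eq_zero_iff_of_nonneg fun b _ => hneg b).1 hsum a (Finset.mem_univ _)
  refine Wtf.ext' (fun j i => ?_) ht
  have hmono : StrictMono (g.w j) := fun a b hab => by
    have := hev j b a 0
    simp only [ht] at this
    have hab' : ((a : ℕ) : ℤ) < ((b : ℕ) : ℤ) := by exact_mod_cast hab
    have h3 := this.1 (by simpa using hab')
    exact Fin.lt_def.2 (by simpa using h3)
  simp [hmono.eq_id]

end Orbit

section Descent

variable {n f p : ℕ}

/-- Half-spaces bounded by the walls of `C₀` and not containing `C₀`. -/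
inductive IsSimple : HalfSpace n f → Prop
  | finite (j : Fin f) (a b : Fin n) (h : (a : ℕ) = b + 1) : IsSimple (j, a, b, 0)
  | affine (j : Fin f) (a b : Fin n) (ha : (a : ℕ) = 0) (hb : (b : ℕ) + 1 = n) :
      IsSimple (j, a, b, 1)

theorem IsSimple.ne (hn : 2 ≤ n) {S : HalfSpace n f} (hS : IsSimple S) : S.2.1 ≠ S.2.2.1 := by
  cases hS with
  | finite j a b h => intro e; simp only [Fin.ext_iff] at e; omega
  | affine j a b ha hb => intro e; simp only [Fin.ext_iff] at e; omega

theorem IsSimple.ev_neg (hnp : n < p) {S : HalfSpace n f} (hS : IsSimple S) :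
    ev p S (basePt n f) < 0 := by
  rw [ev_basePt, Int.cast_lt_zero]
  cases hS with
  | finite j a b h => simp only [mul_zero]; omega
  | affine j a b ha hb => simp only [mul_one]; omega

/-- A simple affine reflection crosses a single hyperplane. -/
theorem IsSimple.eq_of_ev (hn : 2 ≤ n) (hnp : n < p) {S : HalfSpace n f} (hS : IsSimple S)
    {h : HalfSpace n f} (h₁ : ev p h (basePt n f) < 0)
    (h₂ : 0 < ev p h (dotR p (reflElt S) (basePt n f))) : h = S := by
  have hinv : (reflElt S)⁻¹ = reflElt S := inv_eq_of_mul_eq_one_left (refl_mul_self S)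
  rw [ev_dotR, ev_basePt, hinv, Int.cast_pos] at h₂
  rw [ev_basePt, Int.cast_lt_zero] at h₁
  obtain ⟨j', a', b', m⟩ := h
  have ha' := a'.isLt
  have hb' := b'.isLt
  simp only [act, reflElt] at h₁ h₂
  have hm : (m ≤ -1 ∧ (p : ℤ) * m ≤ -p) ∨ m = 0 ∨ m = 1 ∨ (2 ≤ m ∧ 2 * (p : ℤ) ≤ p * m) := by
    rcases lt_trichotomy m 0 with h | h | h
    · left; constructor
      · omega
      · nlinarith
    · right; left; exact h
    · rcases eq_or_lt_of_le (show 1 ≤ m by omega) with h | h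
      · right; right; left; exact h.symm
      · right; right; right; constructor
        · omega
        · nlinarith
  by_cases hj : j' = S.1
  · cases hS with
    | finite j a b h =>
      simp only at hj
      subst hj
      have ha := a.isLt
      simp only [if_true, ite_self, sub_zero, add_zero, Equiv.swap_apply_def] at h₂
      rw [Prod.mk.injEq, Prod.mk.injEq, Prod.mk.injEq]
      refine ⟨rfl, ?_⟩
      simp only [Fin.ext_iff] at h₂ ⊢
      rcases hm with ⟨-, hm⟩ | rfl | rfl | ⟨-, hm⟩ <;> split_ifs at h₂ <;> omega
    | affine j a b ha hb =>
      simp only at hj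
      subst hj
      simp only [if_true, Equiv.swap_apply_def, mul_add, mul_sub] at h₂
      rw [Prod.mk.injEq, Prod.mk.injEq, Prod.mk.injEq]
      refine ⟨rfl, ?_⟩
      simp only [Fin.ext_iff] at h₂ ⊢
      rcases hm with ⟨-, hm⟩ | rfl | rfl | ⟨-, hm⟩ <;> split_ifs at h₂ <;> omega
  · simp only [hj, if_false] at h₂
    simp at h₂
    omega

theorem sameSide_of_mem_box {x y : RPt n f}
    (hx : ∀ (j : Fin f) (a b : Fin n), a < b → 0 < prR x j a b ∧ prR x j a b < p)
    (hy : ∀ (j : Fin f) (a b : Fin n), a < b → 0 < prR y j a b ∧ prR y j a b < p) :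
    SameSide p x y := by
  have key : ∀ {z w : ℝ} (m : ℤ), 0 < z → z < p → 0 < w → z - p * m < 0 → w < p →
      w - p * m < 0 := fun {z w} m hz hzp hw h hwp => by
    have hm : (0 : ℝ) < m := by
      by_contra hm
      nlinarith
    have : (1 : ℝ) ≤ m := by exact_mod_cast (show 0 < m by exact_mod_cast hm)
    nlinarith
  have key' : ∀ {z w : ℝ} (m : ℤ), 0 < z → z < p → 0 < w → -z - p * m < 0 → w < p →
      -w - p * m < 0 := fun {z w} m hz hzp hw h hwp => by
    have hm : (-1 : ℝ) < m := by
      by_contra hm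
      nlinarith
    have : (0 : ℝ) ≤ m := by
      have : -1 < m := by exact_mod_cast hm
      exact_mod_cast (show 0 ≤ m by omega)
    nlinarith
  rintro ⟨j, a, b, m⟩
  rcases lt_trichotomy a b with hab | rfl | hab
  · obtain ⟨h₁, h₂⟩ := hx j a b hab
    obtain ⟨h₃, h₄⟩ := hy j a b hab
    exact ⟨fun h => key m h₁ h₂ h₃ h h₄, fun h => key m h₃ h₄ h₁ h h₂⟩
  · simp [ev, prR]
  · obtain ⟨h₁, h₂⟩ := hx j b a hab
    obtain ⟨h₃, h₄⟩ := hy j b a hab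
    have hneg : ∀ z : RPt n f, prR z j a b = -prR z j b a := fun z => by simp [prR]
    simp only [ev, hneg]
    exact ⟨fun h => key' m h₁ h₂ h₃ h h₄, fun h => key' m h₃ h₄ h₁ h h₂⟩

theorem box_of_isSimple (hn : 2 ≤ n) {x : RPt n f}
    (hx : ∀ S : HalfSpace n f, IsSimple S → ev p S x < 0) (j : Fin f) (a b : Fin n)
    (hab : a < b) : 0 < prR x j a b ∧ prR x j a b < p := by
  obtain ⟨m, rfl⟩ : ∃ m, n = m + 1 := ⟨n - 1, by omega⟩
  let y : Fin (m + 1) → ℝ := fun i => x j i + eta0 (m + 1) i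
  have hanti : StrictAnti y := Fin.strictAnti_iff_succ_lt.2 fun i => by
    have := hx _ (IsSimple.finite j i.succ i.castSucc (by simp))
    simp only [ev, prR, Int.cast_zero, mul_zero, sub_zero] at this
    simp only [y]
    linarith
  have haff := hx _ (IsSimple.affine j 0 (Fin.last m) (by simp) (by simp))
  have h₁ : y b < y a := hanti hab
  have h₂ : y a ≤ y 0 := hanti.antitone (Fin.zero_le a)
  have h₃ : y (Fin.last m) ≤ y b := hanti.antitone (Fin.le_last b)
  simp only [ev, prR, Int.cast_one, mul_one, y] at *
  constructor <;> linarith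

/-- An alcove other than `C₀` has a wall separating it from `C₀`. -/
theorem exists_wall (hn : 2 ≤ n) (hnp : n < p) (e : Wtf n f) :
    e ∈ Omegaf n f p ∨ ∃ H : HalfSpace n f, H.2.1 ≠ H.2.2.1 ∧
      ev p H (dotR p e (basePt n f)) < 0 ∧ 0 < ev p H (basePt n f) ∧
      ∀ h, ev p h (dotR p e (basePt n f)) < 0 →
        0 < ev p h (dotR p (reflElt H * e) (basePt n f)) → h = H := by
  have hc : dotR p e (dotR p e⁻¹ (basePt n f)) = basePt n f := by
    rw [← dotR_mul, mul_inv_cancel, dotR_one]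
  by_cases hex : ∃ S : HalfSpace n f, IsSimple S ∧ 0 < ev p S (dotR p e⁻¹ (basePt n f))
  · obtain ⟨S, hS, hpos⟩ := hex
    refine Or.inr ⟨act e S, by simpa [act] using hS.ne hn, ?_, ?_, fun h h₁ h₂ => ?_⟩
    · rw [ev_act]; exact hS.ev_neg hnp
    · rwa [← hc, ev_act]
    · rw [ev_dotR] at h₁
      rw [refl_act_mul, dotR_mul, ev_dotR] at h₂
      rw [← hS.eq_of_ev hn hnp h₁ h₂, ← act_mul, mul_inv_cancel, act_one]
  · push Not at hex
    refine Or.inl (mem_Omegaf_of_sameSide hnp ?_)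
    have hbox : SameSide p (basePt n f) (dotR p e⁻¹ (basePt n f)) :=
      sameSide_of_mem_box
        (box_of_isSimple hn fun S hS => hS.ev_neg hnp)
        (box_of_isSimple hn fun S hS =>
          lt_of_le_of_ne (hex S hS) (ev_orbit_ne_zero hnp _ (hS.ne hn)))
    have := hbox.dotR e
    rw [hc] at this
    exact this.symm

theorem lenFrom_refl_mul_lt (hp : 0 < p) {g : Wtf n f} {H : HalfSpace n f}
    (hne : H.2.1 ≠ H.2.2.1) (hg : ev p H (dotR p g (basePt n f)) < 0)
    (h0 : 0 < ev p H (basePt n f)) :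
    lenFrom p (basePt n f) (reflElt H * g) < lenFrom p (basePt n f) g := by
  rw [lenFrom_eq_ncard, lenFrom_eq_ncard]
  have := ncard_between_lt hp (k := opp H) hne.symm (c := basePt n f)
    (x := dotR p (reflElt H * g) (basePt n f)) (by rw [ev_opp]; linarith)
    (by rw [ev_opp, dotR_mul, ev_refl_self p H hne]; linarith)
  rwa [← dotR_mul, ← mul_assoc, refl_opp, refl_mul_self, one_mul] at this

theorem lenFrom_lt_refl_mul (hp : 0 < p) {g : Wtf n f} {H : HalfSpace n f}
    (hne : H.2.1 ≠ H.2.2.1) (hg : ev p H (dotR p g (basePt n f)) < 0)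
    (h0 : ev p H (basePt n f) < 0) :
    lenFrom p (basePt n f) g < lenFrom p (basePt n f) (reflElt H * g) := by
  rw [lenFrom_eq_ncard, lenFrom_eq_ncard, dotR_mul]
  exact ncard_between_lt hp hne h0 hg

theorem exists_mul_Omegaf (hn : 2 ≤ n) (hnp : n < p) (e : Wtf n f) :
    ∃ u ∈ Waf n f, ∃ ω ∈ Omegaf n f p, e = u * ω := by
  induction hlen : lenFrom p (basePt n f) e using Nat.strong_induction_on generalizing e with
  | _ N ih =>
    rcases exists_wall hn hnp e with he | ⟨H, hne, he, h0, -⟩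
    · exact ⟨1, one_mem_Waf, e, he, (one_mul e).symm⟩
    · obtain ⟨u, hu, ω, hω, h⟩ := ih _ (hlen ▸ lenFrom_refl_mul_lt (by omega) hne he h0) _ rfl
      refine ⟨reflElt H * u, mul_mem_Waf (refl_mem_Waf H) hu, ω, hω, ?_⟩
      rw [mul_assoc, ← h, ← mul_assoc, refl_mul_self, one_mul]

/-- The elementary steps of the Bruhat order whose base alcove is that of `d`: reflections
in a hyperplane having `g · C₀` and `d` on the same side. -/
def baseStep (p : ℕ) (d : RPt n f) (g g' : Wtf n f) : Prop :=
  ∃ h : HalfSpace n f, h.2.1 ≠ h.2.2.1 ∧ ev p h d < 0 ∧ ev p h (dotR p g (basePt n f)) < 0 ∧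
    g' = reflElt h * g

/-- Moving the base alcove across one of its walls, towards the side of `g · C₀`. -/
theorem baseStep_cross_wall (hnp : n < p) {e g g' : Wtf n f} {H : HalfSpace n f}
    (hne : H.2.1 ≠ H.2.2.1) (he : ev p H (dotR p e (basePt n f)) < 0)
    (hadj : ∀ h, ev p h (dotR p e (basePt n f)) < 0 →
      0 < ev p h (dotR p (reflElt H * e) (basePt n f)) → h = H)
    (hg : 0 < ev p H (dotR p g (basePt n f)))
    (hgg' : Relation.ReflTransGen (baseStep p (dotR p e (basePt n f))) g g') :
    Relation.ReflTransGen (baseStep p (dotR p (reflElt H * e) (basePt n f))) g g' := by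
  suffices Relation.ReflTransGen (baseStep p (dotR p (reflElt H * e) (basePt n f))) g g' ∧
      Relation.ReflTransGen (baseStep p (dotR p (reflElt H * e) (basePt n f))) g (reflElt H * g') from
    this.1
  induction hgg' with
  | refl =>
    refine ⟨.refl, .single ⟨opp H, hne.symm, ?_, ?_, by rw [refl_opp]⟩⟩
    · rw [ev_opp, dotR_mul, ev_refl_self p H hne]; linarith
    · rw [ev_opp]; linarith
  | tail _ hstep ih =>
    obtain ⟨ih₁, ih₂⟩ := ih
    obtain ⟨h, hhne, hhe, hhz, rfl⟩ := hstep
    by_cases hH : h = H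
    · subst hH
      rw [← mul_assoc, refl_mul_self, one_mul]
      exact ⟨ih₂, ih₁⟩
    · refine ⟨ih₁.tail ⟨h, hhne, ?_, hhz, rfl⟩,
        ih₂.tail ⟨act (reflElt H) h, by simpa [act] using hhne, ?_, ?_, ?_⟩⟩
      · exact lt_of_le_of_ne (not_lt.1 fun hpos => hH (hadj h hhe hpos))
          (ev_orbit_ne_zero hnp _ hhne)
      · rwa [dotR_mul, ev_act]
      · rwa [dotR_mul, ev_act]
      · rw [← mul_assoc, ← mul_assoc, refl_act_mul]

/-- Moving the base alcove to `C₀`, when no hyperplane separates it from both `C₀` and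
`a · C₀` in the wrong direction. -/
theorem baseStep_to_basePt (hn : 2 ≤ n) (hnp : n < p) {a b : Wtf n f} (e : Wtf n f)
    (hsep : ∀ h : HalfSpace n f, ev p h (dotR p e (basePt n f)) < 0 →
      0 < ev p h (basePt n f) → 0 < ev p h (dotR p a (basePt n f)))
    (hab : Relation.ReflTransGen (baseStep p (dotR p e (basePt n f))) a b) :
    Relation.ReflTransGen (baseStep p (basePt n f)) a b := by
  induction hlen : lenFrom p (basePt n f) e using Nat.strong_induction_on generalizing e with
  | _ N ih =>
    rcases exists_wall hn hnp e with he | ⟨H, hne, he, h0, hadj⟩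
    · exact hab.lift id fun g g' ⟨h, hne, h₁, h₂⟩ =>
        ⟨h, hne, (sameSide_of_sameAlcove he h).2 h₁, h₂⟩
    · refine ih _ (hlen ▸ lenFrom_refl_mul_lt (by omega) hne he h0) (reflElt H * e)
        (fun h h₁ h₂ => hsep h ?_ h₂) (baseStep_cross_wall hnp hne he hadj (hsep H he h0) hab) rfl
      by_contra hcon
      have hhne : h.2.1 ≠ h.2.2.1 := by
        intro heq
        simp only [ev, prR, heq] at h₁ h₂
        linarith
      have hcon' : 0 < ev p h (dotR p e (basePt n f)) :=
        lt_of_le_of_ne (not_lt.1 hcon) (ev_orbit_ne_zero hnp _ hhne).symm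
      have hopp := hadj (opp h) (by rw [ev_opp]; linarith) (by rw [ev_opp]; linarith)
      rw [← hopp, ev_opp] at h0
      linarith

end Descent

section Up

variable {n f p : ℕ}

/-- The elementary steps of the up order on `Wtf`. -/
def upStepElt (p : ℕ) (g g' : Wtf n f) : Prop :=
  ∃ h : HalfSpace n f, h.2.1 < h.2.2.1 ∧ ev p h (dotR p g (basePt n f)) < 0 ∧ g' = reflElt h * g

theorem exists_of_alcoveLE {a : Wtf n f} {y : RPt n f}
    (h : alcoveLE p (dotR p a (basePt n f)) y) :
    ∃ u ∈ Waf n f, SameSide p y (dotR p (u * a) (basePt n f)) ∧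
      Relation.ReflTransGen (upStepElt p) a (u * a) := by
  induction h with
  | refl => exact ⟨1, one_mem_Waf, by rw [one_mul]; exact fun _ => Iff.rfl, by rw [one_mul]⟩
  | tail _ hstep ih =>
    obtain ⟨u, hu, hs, hr⟩ := ih
    rcases hstep with hsame | ⟨j, i, k, m, hik, hlt, rfl⟩
    · exact ⟨u, hu, (sameSide_of_sameAlcove hsame).symm.trans hs, hr⟩
    · have hlt' := (hs (j, i, k, m)).1 (by simp only [ev]; linarith)
      refine ⟨reflElt (j, i, k, m) * u, mul_mem_Waf (refl_mem_Waf _) hu, ?_,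
        hr.tail ⟨(j, i, k, m), hik, hlt', mul_assoc _ _ _⟩⟩
      have := hs.dotR (reflElt (j, i, k, m))
      rwa [dotR_refl p (j, i, k, m) hik.ne, ← dotR_mul, ← mul_assoc] at this

theorem upStepElt_of_upOrd (hnp : n < p) {a b : Wtf n f} (h : upOrd p a b) :
    Relation.ReflTransGen (upStepElt p) a b := by
  obtain ⟨hle, hmem⟩ := h
  obtain ⟨u, hu, hs, hr⟩ := exists_of_alcoveLE hle
  have hmem' : b⁻¹ * (u * a) ∈ Waf n f := fun j => by
    have h₁ := hu j
    have h₂ := hmem j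
    rw [Wtf.mul_eq, Wtf.inv_eq, sum_mul_t, sum_inv_t] at h₂
    rw [sum_mul_t, sum_mul_t, sum_inv_t, h₁]
    linarith
  have hs' := hs.dotR b⁻¹
  rw [← dotR_mul, ← dotR_mul, inv_mul_cancel, dotR_one] at hs'
  rwa [inv_mul_eq_one.1 (eq_one_of_sameSide hnp hmem' hs')]

theorem ev_transl (h : HalfSpace n f) (M : ℕ) :
    ev p h (dotR p (transl fun _ i => -((M : ℤ) * eta0 n i)) (basePt n f)) =
      ((((h.2.2.1 : ℕ) : ℤ) - ((h.2.1 : ℕ) : ℤ)) * (1 - p * M) - (p : ℤ) * h.2.2.2 : ℤ) := by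
  simp only [ev, prR, basePt, dotR, transl, eta0, inv_one, Equiv.Perm.one_apply]
  push_cast
  ring

/-- The up order is the Bruhat order with respect to a sufficiently antidominant base alcove. -/
theorem baseStep_transl_of_upStepElt (hp : 2 ≤ p) {a b : Wtf n f}
    (h : Relation.ReflTransGen (upStepElt p) a b) :
    ∃ N : ℕ, ∀ M : ℕ, N ≤ M → Relation.ReflTransGen
      (baseStep p (dotR p (transl fun _ i => -((M : ℤ) * eta0 n i)) (basePt n f))) a b := by
  induction h with
  | refl => exact ⟨0, fun _ _ => .refl⟩
  | tail _ hstep ih =>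
    obtain ⟨N, hN⟩ := ih
    obtain ⟨h, hlt, hneg, rfl⟩ := hstep
    refine ⟨max N (h.2.2.2.natAbs + 1), fun M hM =>
      (hN M ((le_max_left _ _).trans hM)).tail ⟨h, hlt.ne, ?_, hneg, rfl⟩⟩
    rw [ev_transl, Int.cast_lt_zero]
    have h₁ : h.2.2.2.natAbs + 1 ≤ M := (le_max_right _ _).trans hM
    have h₂ : -h.2.2.2 + 1 ≤ (M : ℤ) := by omega
    have h₃ : (1 : ℤ) ≤ ((h.2.2.1 : ℕ) : ℤ) - ((h.2.1 : ℕ) : ℤ) := by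
      have : (h.2.1 : ℕ) < h.2.2.1 := hlt
      omega
    have h₄ : (2 : ℤ) ≤ p := by exact_mod_cast hp
    have h₅ : (1 : ℤ) ≤ M := by omega
    have h₆ : 1 - (p : ℤ) * M ≤ 0 := by nlinarith
    have h₇ : (p : ℤ) * (-h.2.2.2 + 1) ≤ p * M := by gcongr
    nlinarith

/-- An antidominant translate of `C₀` is separated from `C₀` only by hyperplanes lying
below every dominant alcove. -/
theorem ev_pos_of_dominant (hp : 0 < p) {a : Wtf n f} (ha : a ∈ WtfPlus n f p) (M : ℕ)
    (h : HalfSpace n f)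
    (h₁ : ev p h (dotR p (transl fun _ i => -((M : ℤ) * eta0 n i)) (basePt n f)) < 0)
    (h₂ : 0 < ev p h (basePt n f)) (hnp : n < p) : 0 < ev p h (dotR p a (basePt n f)) := by
  rw [ev_transl, Int.cast_lt_zero] at h₁
  rw [ev_basePt, Int.cast_pos] at h₂
  obtain ⟨j, i, k, m⟩ := h
  simp only at h₁ h₂
  have hk := k.isLt
  have hp' : (0 : ℤ) < p := by exact_mod_cast hp
  have hik : i < k := by
    by_contra hle
    have : (k : ℕ) ≤ i := not_lt.1 hle
    have hki : ((k : ℕ) : ℤ) - ((i : ℕ) : ℤ) ≤ 0 := by omega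
    nlinarith [mul_nonneg hp'.le (Nat.cast_nonneg (α := ℤ) M)]
  have hm : m ≤ 0 := by
    by_contra hm
    have : (p : ℤ) ≤ p * m := by nlinarith
    omega
  have hm' : (m : ℝ) ≤ 0 := by exact_mod_cast hm
  have hpm : (p : ℝ) * m ≤ 0 := mul_nonpos_of_nonneg_of_nonpos (Nat.cast_nonneg p) hm'
  have := ha j i k hik
  simp only [ev]
  linarith

end Up

theorem bruhatLE_of_baseStep {n f p : ℕ} (hn : 2 ≤ n) (hnp : n < p) {a b : Wtf n f}
    (h : Relation.ReflTransGen (baseStep p (basePt n f)) a b) : bruhatLE p a b := by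
  obtain ⟨u, hu, ω, hω, rfl⟩ := exists_mul_Omegaf (p := p) hn hnp a
  suffices ∃ v ∈ Waf n f, b = v * ω ∧
      Relation.ReflTransGen (bruhatStepFrom p (basePt n f)) u v by
    obtain ⟨v, hv, hb, huv⟩ := this
    exact ⟨u, v, ω, hu, hv, hω, rfl, hb, huv⟩
  induction h with
  | refl => exact ⟨u, hu, rfl, .refl⟩
  | tail _ hstep ih =>
    obtain ⟨v, hv, rfl, huv⟩ := ih
    obtain ⟨H, hne, h0, hvω, rfl⟩ := hstep
    refine ⟨reflElt H * v, mul_mem_Waf (refl_mem_Waf H) hv, (mul_assoc _ _ _).symm,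
      huv.tail ⟨reflElt H, isRefl_refl p H hne, rfl, lenFrom_lt_refl_mul (by omega) hne ?_ h0⟩⟩
    rw [dotR_mul] at hvω
    exact (((sameSide_of_sameAlcove hω).dotR v) H).2 hvω

/-- if `w̃₂ ↑ w̃₁` and `w̃₂ ∈ Wtf⁺`, then `w̃₂ ≤ w̃₁` in the Bruhat
order relative to the dominant base alcove. -/
theorem statement10 (n f p : ℕ) (hn : 2 ≤ n) (hf : 1 ≤ f) (hp : p.Prime) (hnp : n < p)
    (a b : Wtf n f) (hup : upOrd p a b) (ha : a ∈ WtfPlus n f p) :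
    bruhatLE p a b := by
  obtain ⟨N, hN⟩ := baseStep_transl_of_upStepElt hp.two_le (upStepElt_of_upOrd hnp hup)
  exact bruhatLE_of_baseStep hn hnp (baseStep_to_basePt hn hnp _
    (fun h h₁ h₂ => ev_pos_of_dominant hp.pos ha N h h₁ h₂ hnp) (hN N le_rfl))

end LLLSerre
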